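/- arXiv:1907.00384 — 8 statements merged into one kernel-verified Lean document; each statement's English description precedes it below -/
import Mathlib

section
/- Let ι be a nonempty directed preordered type, let G : ι → Type be a directed system of commutative rings with transition ring homomorphisms f i j, and let R = Ring.DirectLimit G f be its direct limit. Then for every n and every invertible n × n matrix M over R there exist an index i and an invertible n × n matrix N over G i such that applying the canonical ring homomorphism G i → R to N entrywise yields M. (In other words, the functor GL_n preserves filtered colimits of commutative rings.) -/
namespace Ring.DirectLimit

variable {ι : Type*} [Preorder ι] [IsDirectedOrder ι] {G : ι → Type*} [∀ i, CommRing (G i)]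

/-- A finite family of elements of a direct limit comes from a family in a single component. -/
theorem exists_of_family [Nonempty ι] {f : ∀ i j, i ≤ j → G i → G j}
    {κ : Type*} [Finite κ] (z : κ → Ring.DirectLimit G f) :
    ∃ (i : ι) (x : κ → G i), ∀ k, of G f i (x k) = z k := by
  choose i x hx using fun k ↦ exists_of (z k)
  obtain ⟨j, hj⟩ := Finite.exists_le i
  exact ⟨j, fun k ↦ f (i k) j (hj k) (x k), fun k ↦ by rw [of_f, hx]⟩

/-- An element of a component that becomes a unit in the direct limit is already a unit in some
larger component. -/
theorem exists_isUnit_of_isUnit_of {f : ∀ i j, i ≤ j → G i →+* G j}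
    [DirectedSystem G fun i j h ↦ f i j h] {i : ι} {x : G i}
    (hx : IsUnit (of G (fun i j h ↦ f i j h) i x)) :
    ∃ (j : ι) (hij : i ≤ j), IsUnit (f i j hij x) := by
  have := Nonempty.intro i
  obtain ⟨y, hxy⟩ := hx.exists_right_inv
  obtain ⟨k, y, rfl⟩ := exists_of y
  obtain ⟨l, hil, hkl⟩ := exists_ge_ge i k
  have hl : of G (fun i j h ↦ f i j h) l (f i l hil x * f k l hkl y - 1) = 0 := by
    rw [map_sub, map_mul, map_one, of_f (f := fun i j h ↦ f i j h) hil,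
      of_f (f := fun i j h ↦ f i j h) hkl, hxy, sub_self]
  obtain ⟨j, hlj, hj⟩ := of.zero_exact hl
  rw [map_sub, map_mul, map_one, sub_eq_zero,
    DirectedSystem.map_map' (f := fun i j h ↦ f i j h) hil hlj] at hj
  exact ⟨j, hil.trans hlj, .of_mul_eq_one _ hj⟩

end Ring.DirectLimit

/-- The functor `GL_n` preserves filtered colimits of commutative rings: every invertible
matrix over the direct limit of a directed system of commutative rings comes from an
invertible matrix over one of the components. -/
theorem gl_preserves_filtered_colimits
    {ι : Type*} [Preorder ι] [IsDirected ι (· ≤ ·)] [Nonempty ι]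
    (G : ι → Type*) [∀ i, CommRing (G i)]
    (f : ∀ i j, i ≤ j → G i →+* G j)
    [DirectedSystem G fun i j h => f i j h]
    (n : ℕ) (M : GL (Fin n) (Ring.DirectLimit G fun i j h => f i j h)) :
    ∃ (i : ι) (N : GL (Fin n) (G i)),
      Matrix.GeneralLinearGroup.map (Ring.DirectLimit.of G (fun i j h => f i j h) i) N = M := by
  obtain ⟨i, x, hx⟩ := Ring.DirectLimit.exists_of_family
    fun p : Fin n × Fin n ↦ M.val p.1 p.2
  let A : Matrix (Fin n) (Fin n) (G i) := .of fun a b ↦ x (a, b)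
  have hA : (Ring.DirectLimit.of G (fun i j h => f i j h) i).mapMatrix A = M := by
    ext a b
    exact hx (a, b)
  have hdet : IsUnit (Ring.DirectLimit.of G (fun i j h => f i j h) i A.det) := by
    rw [RingHom.map_det, hA]
    exact (Matrix.isUnit_iff_isUnit_det _).mp M.isUnit
  obtain ⟨j, hij, hj⟩ := Ring.DirectLimit.exists_isUnit_of_isUnit_of hdet
  rw [RingHom.map_det, ← Matrix.isUnit_iff_isUnit_det] at hj
  refine ⟨j, hj.unit, ?_⟩
  ext a b
  exact (Ring.DirectLimit.of_f (f := fun i j h => f i j h) hij (x (a, b))).trans (hx (a, b))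
end

section
/- Let k be a commutative ring, n a natural number, and let d ∈ MvPolynomial (Fin n × Fin n) k be the determinant of the generic n × n matrix whose (i, j) entry is the variable X(i, j). Let A_n = Localization.Away d be the localization of MvPolynomial (Fin n × Fin n) k away from d. Then for every commutative k-algebra R, the map sending a k-algebra homomorphism φ : A_n → R to the n × n matrix over R whose (i, j) entry is the image under φ of (the image in A_n of) X(i, j) is a bijection from the set of k-algebra homomorphisms A_n → R onto the set of invertible n × n matrices over R. (That is, the group functor GL_n is represented by the affine scheme Spec k[x_{ij}][det(x_{ij})^{-1}].) -/
/-- The group functor `GL_n` is represented by the affine scheme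
`Spec k[x_{ij}][det(x_{ij})⁻¹]`: for every commutative `k`-algebra `R`, evaluation of a
`k`-algebra homomorphism `A_n = k[x_{ij}][det⁻¹] → R` on the entries of the generic matrix
is a bijection onto the set of invertible `n × n` matrices over `R`. -/
theorem gl_representable
    (k : Type*) [CommRing k] (n : ℕ)
    (d : MvPolynomial (Fin n × Fin n) k)
    (hd : d = (Matrix.of fun i j : Fin n => MvPolynomial.X (i, j)).det)
    (R : Type*) [CommRing R] [Algebra k R] :
    Function.Injective
      (fun φ : Localization.Away d →ₐ[k] R =>
        Matrix.of fun i j : Fin n =>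
          φ (algebraMap (MvPolynomial (Fin n × Fin n) k) (Localization.Away d)
              (MvPolynomial.X (i, j)))) ∧
    Set.range
      (fun φ : Localization.Away d →ₐ[k] R =>
        Matrix.of fun i j : Fin n =>
          φ (algebraMap (MvPolynomial (Fin n × Fin n) k) (Localization.Away d)
              (MvPolynomial.X (i, j)))) =
      {M : Matrix (Fin n) (Fin n) R | IsUnit M} := by
  have hdet : ∀ f : MvPolynomial (Fin n × Fin n) k →ₐ[k] R,
      f d = (Matrix.of fun i j : Fin n => f (MvPolynomial.X (i, j))).det := fun f => by
    rw [hd, AlgHom.map_det]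
    rfl
  refine ⟨fun φ ψ h => ?_, Set.Subset.antisymm ?_ fun M hM => ?_⟩
  · refine IsLocalization.algHom_ext (Submonoid.powers d) (MvPolynomial.algHom_ext fun p => ?_)
    exact congrFun (congrFun h p.1) p.2
  · rintro _ ⟨φ, rfl⟩
    rw [Set.mem_ofPred_eq, Matrix.isUnit_iff_isUnit_det]
    have hu := (IsLocalization.Away.algebraMap_isUnit (S := Localization.Away d) d).map φ
    exact hdet (φ.comp (Algebra.algHom k _ (Localization.Away d))) ▸ hu
  · have hu : IsUnit (MvPolynomial.aeval (R := k) (fun p : Fin n × Fin n => M p.1 p.2) d) := by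
      simp only [hdet, MvPolynomial.aeval_X]
      exact (Matrix.isUnit_iff_isUnit_det M).mp hM
    refine ⟨IsLocalization.Away.liftAlgHom d hu, ?_⟩
    ext i j
    simp
end

section
/- Let R be a commutative ring, F an R-module, and let M = DualNumber R ⊗[R] F, regarded as a module over the dual numbers DualNumber R (where ε² = 0). For α : F →ₗ[R] F, let Φ(α) = id_M + ε • (α.baseChange (DualNumber R)), a DualNumber R-linear endomorphism of M. Then: (i) Φ(α + β) = Φ(α) ∘ Φ(β) for all α, β; (ii) Φ is injective; (iii) the image of Φ consists exactly of those DualNumber R-linear endomorphisms ψ of M such that ψ(m) − m lies in ε • M for every m ∈ M; and (iv) every such ψ is bijective. In particular, Φ is a group isomorphism from the additive group of R-linear endomorphisms of F onto the group of DualNumber R-linear automorphisms of M reducing to the identity modulo ε. -/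
open TensorProduct

set_option synthInstance.maxHeartbeats 1000000

/-- For an `R`-linear endomorphism `α` of `F`, the endomorphism `id + ε • α` of the
base change `M = R[ε] ⊗[R] F` to the dual numbers. -/
noncomputable def deformAut (R : Type*) [CommRing R] (F : Type*) [AddCommGroup F] [Module R F]
    (α : F →ₗ[R] F) :
    (DualNumber R ⊗[R] F) →ₗ[DualNumber R] (DualNumber R ⊗[R] F) :=
  LinearMap.id + (DualNumber.eps : DualNumber R) • (α.baseChange (DualNumber R))

namespace DualNumber

variable {R : Type*} [CommRing R] {F : Type*} [AddCommGroup F] [Module R F]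

/-- The coefficient of `1` of an element of `R[ε] ⊗[R] F`. -/
noncomputable def tensorFst : DualNumber R ⊗[R] F →ₗ[R] F :=
  TensorProduct.lid R F ∘ₗ (TrivSqZeroExt.fstHom R R R).toLinearMap.rTensor F

/-- The coefficient of `ε` of an element of `R[ε] ⊗[R] F`. -/
noncomputable def tensorSnd : DualNumber R ⊗[R] F →ₗ[R] F :=
  TensorProduct.lid R F ∘ₗ (TrivSqZeroExt.sndHom R R).rTensor F

@[simp]
theorem tensorFst_tmul (x : DualNumber R) (f : F) :
    tensorFst (x ⊗ₜ[R] f) = TrivSqZeroExt.fst x • f := by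
  simp [tensorFst]

@[simp]
theorem tensorSnd_tmul (x : DualNumber R) (f : F) :
    tensorSnd (x ⊗ₜ[R] f) = TrivSqZeroExt.snd x • f := by
  simp [tensorSnd]

theorem eps_smul_eq_tmul (m : DualNumber R ⊗[R] F) :
    (eps : DualNumber R) • m = eps ⊗ₜ[R] tensorFst m := by
  induction m with
  | zero => simp
  | add x y hx hy => rw [smul_add, hx, hy, map_add, TensorProduct.tmul_add]
  | tmul x f =>
    rw [TensorProduct.smul_tmul', tensorFst_tmul, ← TensorProduct.smul_tmul]
    congr 1
    ext <;> simp

end DualNumber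

section DeformAut

variable {R : Type*} [CommRing R] {F : Type*} [AddCommGroup F] [Module R F]

theorem deformAut_apply (α : F →ₗ[R] F) (m : DualNumber R ⊗[R] F) :
    deformAut R F α m = m + (DualNumber.eps : DualNumber R) • α.baseChange (DualNumber R) m :=
  rfl

theorem deformAut_one_tmul (α : F →ₗ[R] F) (f : F) :
    deformAut R F α (1 ⊗ₜ[R] f) = 1 ⊗ₜ[R] f + DualNumber.eps ⊗ₜ[R] α f := by
  simp [deformAut_apply, DualNumber.eps_smul_eq_tmul]

theorem deformAut_zero : deformAut R F 0 = LinearMap.id :=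
  LinearMap.ext fun m => by simp [deformAut_apply]

theorem deformAut_add (α β : F →ₗ[R] F) :
    deformAut R F (α + β) = deformAut R F α ∘ₗ deformAut R F β := by
  refine LinearMap.ext fun m => ?_
  have h (n : DualNumber R ⊗[R] F) :
      (DualNumber.eps : DualNumber R) • (DualNumber.eps : DualNumber R) • n = 0 := by
    rw [smul_smul, DualNumber.eps_mul_eps, zero_smul]
  simp only [LinearMap.comp_apply, deformAut_apply, map_add, map_smul, smul_add, h,
    LinearMap.baseChange_add, LinearMap.add_apply]
  abel

theorem deformAut_injective : Function.Injective (deformAut R F) := by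
  intro α β h
  ext f
  have hf := congrArg DualNumber.tensorSnd (LinearMap.congr_fun h (1 ⊗ₜ[R] f))
  simpa [deformAut_one_tmul] using hf

theorem deformAut_bijective (α : F →ₗ[R] F) : Function.Bijective (deformAut R F α) := by
  refine Function.bijective_iff_has_inverse.2 ⟨deformAut R F (-α), fun m => ?_, fun m => ?_⟩ <;>
    rw [← LinearMap.comp_apply, ← deformAut_add] <;> simp [deformAut_zero]

theorem range_deformAut :
    Set.range (deformAut R F) =
      {ψ : (DualNumber R ⊗[R] F) →ₗ[DualNumber R] (DualNumber R ⊗[R] F) |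
        ∀ m, ψ m - m ∈
          Set.range fun y : DualNumber R ⊗[R] F => (DualNumber.eps : DualNumber R) • y} := by
  ext ψ
  constructor
  · rintro ⟨α, rfl⟩ m
    exact ⟨α.baseChange (DualNumber R) m, by simp [deformAut_apply]⟩
  · intro h
    refine ⟨DualNumber.tensorSnd ∘ₗ ψ.restrictScalars R ∘ₗ TensorProduct.mk R _ F 1, ?_⟩
    ext f
    obtain ⟨y, hy⟩ := h (1 ⊗ₜ[R] f)
    have hψ : ψ (1 ⊗ₜ[R] f) = 1 ⊗ₜ[R] f + DualNumber.eps ⊗ₜ[R] DualNumber.tensorFst y := by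
      rw [← DualNumber.eps_smul_eq_tmul, ← sub_eq_iff_eq_add']
      exact hy.symm
    simp [deformAut_one_tmul, hψ]

end DeformAut

/-- Deformations of the identity automorphism of a module `F` over the square-zero extension
`R[ε]` are classified by endomorphisms of `F`: the map `α ↦ id + ε•α` is (i) additive-to-
multiplicative, (ii) injective, (iii) has range exactly the `R[ε]`-linear endomorphisms of
`M = R[ε] ⊗[R] F` reducing to the identity modulo `ε`, and (iv) all such endomorphisms are
bijective. -/
theorem deformations_of_identity
    (R : Type*) [CommRing R] (F : Type*) [AddCommGroup F] [Module R F] :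
    (∀ α β : F →ₗ[R] F,
      deformAut R F (α + β) = (deformAut R F α) ∘ₗ (deformAut R F β)) ∧
    Function.Injective (deformAut R F) ∧
    Set.range (deformAut R F) =
      {ψ : (DualNumber R ⊗[R] F) →ₗ[DualNumber R] (DualNumber R ⊗[R] F) |
        ∀ m, ψ m - m ∈
          Set.range fun y : DualNumber R ⊗[R] F => (DualNumber.eps : DualNumber R) • y} ∧
    (∀ ψ : (DualNumber R ⊗[R] F) →ₗ[DualNumber R] (DualNumber R ⊗[R] F),
      (∀ m, ψ m - m ∈
          Set.range fun y : DualNumber R ⊗[R] F => (DualNumber.eps : DualNumber R) • y) →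
      Function.Bijective ψ) := by
  refine ⟨deformAut_add, deformAut_injective, range_deformAut, fun ψ hψ => ?_⟩
  obtain ⟨α, rfl⟩ := range_deformAut.ge hψ
  exact deformAut_bijective α
end

section
/- Let R be a commutative ring and M a finite free R-module, and let α : M →ₗ[R] M be an R-linear endomorphism. Let αε denote the base change of α to an endomorphism of the finite free DualNumber R-module DualNumber R ⊗[R] M. Then the determinant of the DualNumber R-linear endomorphism id + ε • αε equals 1 + (trace of α) · ε in DualNumber R. (That is, d/dε det(id + ε·α) = tr(α): the map induced by the determinant on tangent spaces is the trace.) -/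
open TensorProduct

set_option synthInstance.maxHeartbeats 1000000

theorem LinearMap.det_id_add_smul_of_sq_eq_zero {S N : Type*} [CommRing S] [AddCommGroup N]
    [Module S N] [Module.Free S N] [Module.Finite S N] {s : S} (hs : s ^ 2 = 0)
    (f : N →ₗ[S] N) :
    LinearMap.det (LinearMap.id + s • f) = 1 + LinearMap.trace S N f * s := by
  classical
  let b := Module.Free.chooseBasis S N
  rw [← LinearMap.det_toMatrix b, LinearMap.trace_eq_matrix_trace S b, map_add, map_smul,
    LinearMap.toMatrix_id, Matrix.det_one_add_smul, hs, mul_zero, add_zero]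

/-- For a finite free `R`-module `M` and an endomorphism `α` of `M`, the determinant of
`id + ε • α` (an endomorphism of the base change of `M` to the dual numbers `R[ε]`) equals
`1 + tr(α) · ε`: the map induced by the determinant on tangent spaces is the trace. -/
theorem det_one_add_eps_smul_eq_one_add_trace_smul_eps
    (R : Type*) [CommRing R] (M : Type*) [AddCommGroup M] [Module R M]
    [Module.Free R M] [Module.Finite R M] (α : M →ₗ[R] M) :
    LinearMap.det
        (LinearMap.id + (DualNumber.eps : DualNumber R) • (α.baseChange (DualNumber R)) :
          (DualNumber R ⊗[R] M) →ₗ[DualNumber R] (DualNumber R ⊗[R] M)) =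
      1 + (LinearMap.trace R M α) • (DualNumber.eps : DualNumber R) := by
  rw [LinearMap.det_id_add_smul_of_sq_eq_zero (by rw [pow_two, DualNumber.eps_mul_eps]),
    LinearMap.trace_baseChange, Algebra.smul_def]
end

section
/- Let R be a commutative ring, M and N two R-modules, and k a natural number. Then there is an R-linear isomorphism between the k-th exterior power ⋀[R]^k (M × N) of the direct sum M × N and the direct sum over 0 ≤ i ≤ k of the tensor products (⋀[R]^i M) ⊗[R] (⋀[R]^(k−i) N). -/
open TensorProduct DirectSum

namespace CliffordAlgebra

/-- For a quadratic form on `M × N` that is the orthogonal sum of `Q₁` and `Q₂`, multiplication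
of the images of the two Clifford algebras is injective on their tensor product. -/
theorem mul'_comp_map_injective {R M N : Type*} [CommRing R] [AddCommGroup M] [Module R M]
    [AddCommGroup N] [Module R N] {Q₁ : QuadraticForm R M} {Q₂ : QuadraticForm R N}
    {Q : QuadraticForm R (M × N)} (hQ : Q = Q₁.prod Q₂) (f : Q₁ →qᵢ Q) (g : Q₂ →qᵢ Q)
    (hf : ∀ x, f x = (x, 0)) (hg : ∀ y, g y = (0, y)) :
    Function.Injective (LinearMap.mul' R (CliffordAlgebra Q) ∘ₗ
      TensorProduct.map (CliffordAlgebra.map f).toLinearMap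
        (CliffordAlgebra.map g).toLinearMap) := by
  subst hQ
  obtain rfl : f = .inl Q₁ Q₂ := QuadraticMap.Isometry.ext hf
  obtain rfl : g = .inr Q₁ Q₂ := QuadraticMap.Isometry.ext hg
  have h : LinearMap.mul' R (CliffordAlgebra (Q₁.prod Q₂)) ∘ₗ
      TensorProduct.map (CliffordAlgebra.map (.inl Q₁ Q₂)).toLinearMap
        (CliffordAlgebra.map (.inr Q₁ Q₂)).toLinearMap =
      (prodEquiv Q₁ Q₂).symm.toLinearMap ∘ₗ
        (GradedTensorProduct.of R (evenOdd Q₁) (evenOdd Q₂)).toLinearMap := by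
    refine TensorProduct.ext' fun a b => ?_
    change _ = toProd Q₁ Q₂ (GradedTensorProduct.tmul R a b)
    rw [toProd, GradedTensorProduct.lift_tmul]
    rfl
  rw [h]
  exact (prodEquiv Q₁ Q₂).symm.injective.comp (LinearEquiv.injective _)

end CliffordAlgebra

theorem Commute.add_pow_le_sum {α : Type*} [IdemSemiring α] {a b : α} (h : Commute a b) (n : ℕ) :
    (a + b) ^ n ≤ ∑ i ∈ Finset.range (n + 1), a ^ i * b ^ (n - i) := by
  have natCast_le_one (m : ℕ) : (m : α) ≤ 1 := by
    induction m with
    | zero => simp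
    | succ m ih => rw [Nat.cast_succ, add_eq_sup]; exact sup_le ih le_rfl
  rw [h.add_pow]
  refine Finset.sum_le_sum fun i _ => ?_
  simpa using mul_le_mul_right (natCast_le_one (n.choose i)) (a ^ i * b ^ (n - i))

namespace ExteriorAlgebra

variable (R M N : Type*) [CommRing R] [AddCommGroup M] [Module R M] [AddCommGroup N] [Module R N]

/-- The product map `a ⊗ b ↦ a ∧ b` into the exterior algebra of a direct sum. -/
noncomputable def prodMul :
    ExteriorAlgebra R M ⊗[R] ExteriorAlgebra R N →ₗ[R] ExteriorAlgebra R (M × N) :=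
  LinearMap.mul' R _ ∘ₗ TensorProduct.map (map (.inl R M N)).toLinearMap
    (map (.inr R M N)).toLinearMap

theorem prodMul_injective : Function.Injective (prodMul R M N) :=
  CliffordAlgebra.mul'_comp_map_injective (by ext; simp) _ _ (fun _ => rfl) (fun _ => rfl)

/-- The inclusion of the summands of total degree `k` in the tensor product of two exterior
algebras. -/
noncomputable def totalDegreeIncl (k : ℕ) :
    (⨁ i : Fin (k + 1), (⋀[R]^(i : ℕ) M) ⊗[R] (⋀[R]^(k - (i : ℕ)) N)) →ₗ[R]
      ExteriorAlgebra R M ⊗[R] ExteriorAlgebra R N :=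
  DirectSum.toModule R _ _ fun i => TensorProduct.mapIncl (⋀[R]^(i : ℕ) M) (⋀[R]^(k - (i : ℕ)) N)

/-- The projection of the exterior algebra onto its component of degree `i`. -/
noncomputable def degreeProj (i : ℕ) : ExteriorAlgebra R M →ₗ[R] ⋀[R]^i M :=
  DirectSum.component R ℕ (fun i => ⋀[R]^i M) i ∘ₗ
    (DirectSum.decomposeLinearEquiv fun i => ⋀[R]^i M).toLinearMap

variable {R M} in
theorem degreeProj_coe {i : ℕ} (a : ⋀[R]^i M) : degreeProj R M i a = a := by
  simp [degreeProj, DirectSum.component.lof_self]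

variable {R M} in
theorem degreeProj_coe_of_ne {i j : ℕ} (h : i ≠ j) (a : ⋀[R]^i M) : degreeProj R M j a = 0 := by
  simp [degreeProj, DirectSum.component.of, h]

theorem totalDegreeIncl_injective (k : ℕ) : Function.Injective (totalDegreeIncl R M N k) := by
  have key (i : Fin (k + 1)) :
      TensorProduct.map (degreeProj R M i) (degreeProj R N (k - i)) ∘ₗ totalDegreeIncl R M N k =
        DirectSum.component R _ _ i := by
    refine DirectSum.linearMap_ext _ fun j => TensorProduct.ext' fun a b => ?_
    rcases eq_or_ne j i with rfl | h
    · simp [totalDegreeIncl, TensorProduct.mapIncl, degreeProj_coe]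
    · simp [totalDegreeIncl, TensorProduct.mapIncl, degreeProj_coe_of_ne (Fin.val_ne_of_ne h),
        DirectSum.component.of, h]
  intro x y hxy
  refine DirectSum.ext_component R fun i => ?_
  rw [← key]
  simp [hxy]

theorem range_ι_prod :
    LinearMap.range (ι R : M × N →ₗ[R] _) =
      (LinearMap.range (ι R : M →ₗ[R] _)).map (map (.inl R M N)).toLinearMap ⊔
      (LinearMap.range (ι R : N →ₗ[R] _)).map (map (.inr R M N)).toLinearMap := by
  rw [ι_range_map_map, ι_range_map_map, ← Submodule.map_sup, LinearMap.sup_range_inl_inr,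
    LinearMap.range_eq_map]

theorem commute_map_range_ι (p q : Submodule R M) : Commute (p.map (ι R)) (q.map (ι R)) := by
  have h (p q : Submodule R M) : p.map (ι R) * q.map (ι R) ≤ q.map (ι R) * p.map (ι R) := by
    rw [Submodule.mul_le]
    rintro _ ⟨x, hx, rfl⟩ _ ⟨y, hy, rfl⟩
    rw [eq_neg_of_add_eq_zero_left (ι_add_mul_swap x y)]
    exact neg_mem (Submodule.mul_mem_mul ⟨y, hy, rfl⟩ ⟨x, hx, rfl⟩)
  exact le_antisymm (h p q) (h q p)

theorem range_prodMul_comp_totalDegreeIncl (k : ℕ) :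
    LinearMap.range (prodMul R M N ∘ₗ totalDegreeIncl R M N k) = ⋀[R]^k (M × N) := by
  set A := (LinearMap.range (ι R : M →ₗ[R] _)).map (map (.inl R M N)).toLinearMap with hA
  set B := (LinearMap.range (ι R : N →ₗ[R] _)).map (map (.inr R M N)).toLinearMap with hB
  have comm : Commute A B := by
    rw [hA, hB, ι_range_map_map, ι_range_map_map]
    exact commute_map_range_ι ..
  have hAB : ⋀[R]^k (M × N) = (A + B) ^ k := by rw [Submodule.add_eq_sup, ← range_ι_prod]
  have hApow (i : ℕ) : A ^ i = (⋀[R]^i M).map (map (.inl R M N)).toLinearMap :=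
    (Submodule.map_pow _ _ _).symm
  have hBpow (i : ℕ) : B ^ i = (⋀[R]^i N).map (map (.inr R M N)).toLinearMap :=
    (Submodule.map_pow _ _ _).symm
  apply le_antisymm
  · rintro _ ⟨x, rfl⟩
    induction x using DirectSum.induction_on with
    | zero => simp
    | add x y hx hy => rw [map_add]; exact add_mem hx hy
    | of i t =>
      rw [← DirectSum.lof_eq_of R]
      induction t with
      | zero => simp
      | add x y hx hy => rw [map_add, map_add]; exact add_mem hx hy
      | tmul a b =>
        have ha : map (.inl R M N) a ∈ A ^ (i : ℕ) := hApow i ▸ ⟨a, a.2, rfl⟩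
        have hb : map (.inr R M N) b ∈ B ^ (k - i : ℕ) := hBpow _ ▸ ⟨b, b.2, rfl⟩
        have hle : A ^ (i : ℕ) * B ^ (k - i : ℕ) ≤ ⋀[R]^k (M × N) := by
          rw [hAB]
          calc _ ≤ (A + B) ^ (i : ℕ) * (A + B) ^ (k - i : ℕ) :=
                mul_le_mul' (pow_le_pow_left' le_sup_left _)
                  (pow_le_pow_left' le_sup_right _)
            _ = _ := by rw [← pow_add, Nat.add_sub_cancel' i.is_le]
        simpa [totalDegreeIncl, prodMul, TensorProduct.mapIncl] using
          hle (Submodule.mul_mem_mul ha hb)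
  · rw [hAB]
    refine (comm.add_pow_le_sum k).trans
      (Finset.sum_induction _ (· ≤ _) (fun _ _ => sup_le) bot_le fun i hi => ?_)
    rw [hApow, hBpow, Submodule.mul_le]
    rintro _ ⟨a, ha, rfl⟩ _ ⟨b, hb, rfl⟩
    refine ⟨DirectSum.lof R _ _ (⟨i, Finset.mem_range.mp hi⟩ : Fin (k + 1))
      ((⟨a, ha⟩ : ⋀[R]^i M) ⊗ₜ (⟨b, hb⟩ : ⋀[R]^(k - i) N)), ?_⟩
    simp [totalDegreeIncl, prodMul, TensorProduct.mapIncl]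

end ExteriorAlgebra

/-- Binomial decomposition of exterior powers of a direct sum: the `k`-th exterior power of
`M ⊕ N` is isomorphic to the direct sum over `0 ≤ i ≤ k` of `(⋀^i M) ⊗ (⋀^(k-i) N)`. -/
theorem exteriorPower_prod_equiv
    (R : Type*) [CommRing R] (M N : Type*) [AddCommGroup M] [Module R M]
    [AddCommGroup N] [Module R N] (k : ℕ) :
    Nonempty ((⋀[R]^k (M × N)) ≃ₗ[R]
      ⨁ i : Fin (k + 1), (⋀[R]^(i : ℕ) M) ⊗[R] (⋀[R]^(k - (i : ℕ)) N)) :=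
  ⟨((LinearEquiv.ofInjective
      (ExteriorAlgebra.prodMul R M N ∘ₗ ExteriorAlgebra.totalDegreeIncl R M N k)
      ((ExteriorAlgebra.prodMul_injective R M N).comp
        (ExteriorAlgebra.totalDegreeIncl_injective R M N k))).trans
    (LinearEquiv.ofEq _ _
      (ExteriorAlgebra.range_prodMul_comp_totalDegreeIncl R M N k))).symm⟩
end

section
/- Let R be a commutative ring and let 0 → M' →f M →g M'' → 0 be a short exact sequence of R-modules (f injective, g surjective, and the image of f equal to the kernel of g) with M'' projective. Let a, b be natural numbers such that ⋀[R]^(a+1) M' = 0 and ⋀[R]^(b+1) M'' = 0. Then there is an R-linear isomorphism ⋀[R]^(a+b) M ≅ (⋀[R]^a M') ⊗[R] (⋀[R]^b M''). (This is the multiplicativity of the determinant line on short exact sequences, which makes the determinant additive and hence extend to a map on K-theory.) -/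
open TensorProduct

namespace AlternatingMap

variable {R M N₁ N₂ ιa ιb : Type*} [CommRing R] [AddCommGroup M] [Module R M]
  [AddCommGroup N₁] [Module R N₁] [AddCommGroup N₂] [Module R N₂]
  [Fintype ιa] [Fintype ιb] [DecidableEq ιa] [DecidableEq ιb]

/-- If `α` vanishes whenever one of its arguments is one of the vectors `v (Sum.inr j)`, then only
the trivial shuffle contributes to the exterior product of `α` and `β` at `v`. -/
theorem domCoprod_apply_of_eq_zero (α : M [⋀^ιa]→ₗ[R] N₁) (β : M [⋀^ιb]→ₗ[R] N₂)
    (v : ιa ⊕ ιb → M) (hα : ∀ (u : ιa → M) (i : ιa) (j : ιb), u i = v (Sum.inr j) → α u = 0) :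
    α.domCoprod β v = α (fun i => v (Sum.inl i)) ⊗ₜ[R] β (fun j => v (Sum.inr j)) := by
  rw [domCoprod_apply, sum_apply]
  refine (Finset.sum_eq_single (Quotient.mk'' 1) ?_ ?_).trans ?_
  · intro σ _ hσ
    induction σ using Quotient.inductionOn' with | _ σ
    obtain ⟨i, j, hij⟩ : ∃ i j, σ (Sum.inl i) = Sum.inr j := by
      by_contra! h
      refine hσ (Quotient.sound' (QuotientGroup.leftRel_apply.mpr ?_))
      refine Subgroup.mul_mem _ (Subgroup.inv_mem _ ?_) (Subgroup.one_mem _)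
      refine Equiv.Perm.mem_sumCongrHom_range_of_perm_mapsTo_inl ?_
      rintro _ ⟨i, rfl⟩
      rcases hi : σ (Sum.inl i) with k | k
      · exact ⟨k, rfl⟩
      · exact (h i k hi).elim
    have h0 : α (fun k => v (σ (Sum.inl k))) = 0 := hα _ i j (by rw [hij])
    rw [domCoprod.summand_mk'']
    simp [MultilinearMap.domCoprod_apply, h0]
  · simp
  · rw [domCoprod.summand_mk'']
    simp [MultilinearMap.domCoprod_apply]

end AlternatingMap

namespace ExteriorAlgebra

variable {R M₁ M₂ M : Type*} [CommRing R] [AddCommGroup M₁] [Module R M₁]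
  [AddCommGroup M₂] [Module R M₂] [AddCommGroup M] [Module R M]

theorem map_exteriorPower (f : M₁ →ₗ[R] M) (n : ℕ) :
    (⋀[R]^n M₁).map (map f).toLinearMap = (LinearMap.range (ι R ∘ₗ f)) ^ n := by
  rw [Submodule.map_pow, ← LinearMap.range_comp, map_comp_ι]

theorem range_ι_comp_mul_le (f : M₁ →ₗ[R] M) (s : M₂ →ₗ[R] M) :
    LinearMap.range (ι R ∘ₗ f) * LinearMap.range (ι R ∘ₗ s) ≤
      LinearMap.range (ι R ∘ₗ s) * LinearMap.range (ι R ∘ₗ f) := by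
  rw [Submodule.mul_le]
  rintro _ ⟨x, rfl⟩ _ ⟨y, rfl⟩
  rw [LinearMap.comp_apply, LinearMap.comp_apply, eq_neg_of_add_eq_zero_left (ι_add_mul_swap _ _)]
  exact neg_mem (Submodule.mul_mem_mul ⟨y, rfl⟩ ⟨x, rfl⟩)

theorem commute_range_ι_comp (f : M₁ →ₗ[R] M) (s : M₂ →ₗ[R] M) :
    Commute (LinearMap.range (ι R ∘ₗ f)) (LinearMap.range (ι R ∘ₗ s)) :=
  le_antisymm (range_ι_comp_mul_le f s) (range_ι_comp_mul_le s f)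

theorem exteriorPower_add_le (f : M₁ →ₗ[R] M) (s : M₂ →ₗ[R] M)
    (hfs : LinearMap.range f ⊔ LinearMap.range s = ⊤) (a b : ℕ)
    (ha : ⋀[R]^(a + 1) M₁ = ⊥) (hb : ⋀[R]^(b + 1) M₂ = ⊥) :
    ⋀[R]^(a + b) M ≤
      (LinearMap.range (ι R ∘ₗ f)) ^ a * (LinearMap.range (ι R ∘ₗ s)) ^ b := by
  have hι : LinearMap.range (ι R : M →ₗ[R] _) =
      LinearMap.range (ι R ∘ₗ f) + LinearMap.range (ι R ∘ₗ s) := by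
    rw [LinearMap.range_comp, LinearMap.range_comp, Submodule.add_eq_sup, ← Submodule.map_sup, hfs,
      LinearMap.range_eq_map]
  have hP : (LinearMap.range (ι R ∘ₗ f)) ^ (a + 1) = 0 := by
    rw [← map_exteriorPower, ha, Submodule.map_bot, Submodule.zero_eq_bot]
  have hQ : (LinearMap.range (ι R ∘ₗ s)) ^ (b + 1) = 0 := by
    rw [← map_exteriorPower, hb, Submodule.map_bot, Submodule.zero_eq_bot]
  change (LinearMap.range (ι R : M →ₗ[R] _)) ^ (a + b) ≤ _
  rw [hι, (commute_range_ι_comp f s).add_pow]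
  refine Finset.sum_induction _ (· ≤ _) (fun x y hx hy => sup_le hx hy) bot_le fun i hi => ?_
  rcases lt_trichotomy i a with h | rfl | h
  · rw [pow_eq_zero_of_le (show b + 1 ≤ a + b - i by lia) hQ]
    simp
  · rw [Nat.add_sub_cancel_left]
    rw [← nsmul_eq_mul']
    exact (nsmul_eq_self (Nat.choose_pos (Nat.le_add_right _ _)).ne' _).le
  · rw [pow_eq_zero_of_le (show a + 1 ≤ i by lia) hP]
    simp

end ExteriorAlgebra

namespace exteriorPower

variable {R M₁ M₂ M : Type*} [CommRing R] [AddCommGroup M₁] [Module R M₁]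
  [AddCommGroup M₂] [Module R M₂] [AddCommGroup M] [Module R M]

/-- The exterior product of the maps induced by `f` and `s`. -/
noncomputable def mulMap (f : M₁ →ₗ[R] M) (s : M₂ →ₗ[R] M) (a b : ℕ) :
    (⋀[R]^a M₁) ⊗[R] (⋀[R]^b M₂) →ₗ[R] ⋀[R]^(a + b) M :=
  TensorProduct.lift <| LinearMap.mk₂ R
    (fun x y => ⟨map a f x * map b s y, SetLike.mul_mem_graded (map a f x).2 (map b s y).2⟩)
    (fun _ _ _ => Subtype.ext <| by simp [add_mul])
    (fun _ _ _ => Subtype.ext <| by simp)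
    (fun _ _ _ => Subtype.ext <| by simp [mul_add])
    (fun _ _ _ => Subtype.ext <| by simp)

theorem coe_mulMap_tmul (f : M₁ →ₗ[R] M) (s : M₂ →ₗ[R] M) (a b : ℕ)
    (x : ⋀[R]^a M₁) (y : ⋀[R]^b M₂) :
    (mulMap f s a b (x ⊗ₜ y) : ExteriorAlgebra R M) = map a f x * map b s y := rfl

theorem mulMap_ιMulti_tmul_ιMulti (f : M₁ →ₗ[R] M) (s : M₂ →ₗ[R] M) {a b : ℕ}
    (x : Fin a → M₁) (y : Fin b → M₂) :
    mulMap f s a b (ιMulti R a x ⊗ₜ ιMulti R b y) =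
      ιMulti R (a + b) (Fin.append (f ∘ x) (s ∘ y)) := by
  ext
  simp [coe_mulMap_tmul, ExteriorAlgebra.ιMulti_mul_ιMulti]

theorem coe_map (f : M₁ →ₗ[R] M) (n : ℕ) (x : ⋀[R]^n M₁) :
    (map n f x : ExteriorAlgebra R M) = ExteriorAlgebra.map f x := by
  have : (⋀[R]^n M).subtype ∘ₗ map n f =
      (ExteriorAlgebra.map f).toLinearMap ∘ₗ (⋀[R]^n M₁).subtype := by
    ext; simp
  exact LinearMap.congr_fun this x

theorem mulMap_surjective (f : M₁ →ₗ[R] M) (s : M₂ →ₗ[R] M)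
    (hfs : LinearMap.range f ⊔ LinearMap.range s = ⊤) {a b : ℕ}
    (ha : ⋀[R]^(a + 1) M₁ = ⊥) (hb : ⋀[R]^(b + 1) M₂ = ⊥) :
    Function.Surjective (mulMap f s a b) := by
  suffices h : ⋀[R]^(a + b) M ≤ (LinearMap.range (mulMap f s a b)).map (⋀[R]^(a + b) M).subtype by
    intro z
    obtain ⟨_, ⟨t, rfl⟩, ht⟩ := h z.2
    exact ⟨t, Subtype.ext ht⟩
  refine (ExteriorAlgebra.exteriorPower_add_le f s hfs a b ha hb).trans ?_
  rw [← ExteriorAlgebra.map_exteriorPower, ← ExteriorAlgebra.map_exteriorPower, Submodule.mul_le]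
  rintro _ ⟨x, hx, rfl⟩ _ ⟨y, hy, rfl⟩
  refine ⟨_, ⟨⟨x, hx⟩ ⊗ₜ ⟨y, hy⟩, rfl⟩, ?_⟩
  simp [coe_mulMap_tmul, coe_map]

/-- Linear maps out of `⋀[R]^a M₁ ⊗[R] ⋀[R]^b M₂` agree if they agree on tensor products of
exterior products of vectors. -/
theorem tensorProduct_ext {N : Type*} [AddCommGroup N] [Module R N] {a b : ℕ}
    {F G : (⋀[R]^a M₁) ⊗[R] (⋀[R]^b M₂) →ₗ[R] N}
    (h : ∀ (x : Fin a → M₁) (y : Fin b → M₂),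
      F (ιMulti R a x ⊗ₜ ιMulti R b y) = G (ιMulti R a x ⊗ₜ ιMulti R b y)) : F = G := by
  refine TensorProduct.ext (linearMap_ext (AlternatingMap.ext fun x => ?_))
  exact linearMap_ext (AlternatingMap.ext fun y => h x y)

theorem mulMap_injective (f : M₁ →ₗ[R] M) (s : M₂ →ₗ[R] M) (p : M →ₗ[R] M₁) (g : M →ₗ[R] M₂)
    (hpf : p ∘ₗ f = .id) (hps : p ∘ₗ s = 0) (hgs : g ∘ₗ s = .id) (a b : ℕ) :
    Function.Injective (mulMap f s a b) := by
  let φ : M [⋀^Fin (a + b)]→ₗ[R] (⋀[R]^a M₁) ⊗[R] (⋀[R]^b M₂) :=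
    (((ιMulti R a).compLinearMap p).domCoprod ((ιMulti R b).compLinearMap g)).domDomCongr
      finSumFinEquiv
  let Φ : ⋀[R]^(a + b) M →ₗ[R] (⋀[R]^a M₁) ⊗[R] (⋀[R]^b M₂) :=
    alternatingMapLinearEquiv (N := (⋀[R]^a M₁) ⊗[R] (⋀[R]^b M₂)) φ
  have hΦ : Φ ∘ₗ mulMap f s a b = .id := by
    refine tensorProduct_ext (N := (⋀[R]^a M₁) ⊗[R] (⋀[R]^b M₂)) fun x y => ?_
    have hf (x) : p (f x) = x := LinearMap.congr_fun hpf x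
    have hs (y) : p (s y) = 0 := LinearMap.congr_fun hps y
    have hg (y) : g (s y) = y := LinearMap.congr_fun hgs y
    rw [LinearMap.comp_apply, LinearMap.id_apply, mulMap_ιMulti_tmul_ιMulti,
      alternatingMapLinearEquiv_apply_ιMulti,
      AlternatingMap.domDomCongr_apply, AlternatingMap.domCoprod_apply_of_eq_zero]
    · simp [Function.comp_def, hf, hg]
    · intro u i j hu
      refine (ιMulti R a).map_coord_zero i ?_
      simp [hu, hs]
  exact Function.LeftInverse.injective (g := Φ) (LinearMap.congr_fun hΦ)

end exteriorPower

/-- Multiplicativity of the determinant line on short exact sequences: given a short exact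
sequence `0 → M' → M → M'' → 0` of `R`-modules with `M''` projective, and `a`, `b` such that
`⋀^(a+1) M' = 0` and `⋀^(b+1) M'' = 0`, one has `⋀^(a+b) M ≅ (⋀^a M') ⊗ (⋀^b M'')`. -/
theorem det_multiplicative_of_shortExact
    (R : Type*) [CommRing R] (M' M M'' : Type*)
    [AddCommGroup M'] [Module R M'] [AddCommGroup M] [Module R M]
    [AddCommGroup M''] [Module R M'']
    (f : M' →ₗ[R] M) (g : M →ₗ[R] M'')
    (hf : Function.Injective f) (hg : Function.Surjective g)
    (hfg : LinearMap.range f = LinearMap.ker g)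
    [Module.Projective R M'']
    (a b : ℕ) (ha : ⋀[R]^(a + 1) M' = ⊥) (hb : ⋀[R]^(b + 1) M'' = ⊥) :
    Nonempty ((⋀[R]^(a + b) M) ≃ₗ[R] (⋀[R]^a M') ⊗[R] (⋀[R]^b M'')) := by
  obtain ⟨s, hs⟩ := Module.projective_lifting_property g LinearMap.id hg
  have hgs (y : M'') : g (s y) = y := LinearMap.congr_fun hs y
  have hgf (x : M') : g (f x) = 0 := LinearMap.mem_ker.mp (hfg ▸ LinearMap.mem_range_self f x)
  have hmem (m : M) : m - s (g m) ∈ LinearMap.range f := by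
    rw [hfg, LinearMap.mem_ker, map_sub, hgs, sub_self]
  let p : M →ₗ[R] M' := (LinearEquiv.ofInjective f hf).symm.toLinearMap ∘ₗ
    (LinearMap.id - s ∘ₗ g).codRestrict (LinearMap.range f) hmem
  have hfp (m : M) : f (p m) = m - s (g m) :=
    congrArg Subtype.val ((LinearEquiv.ofInjective f hf).apply_symm_apply ⟨m - s (g m), hmem m⟩)
  have hpf : p ∘ₗ f = .id := LinearMap.ext fun x => hf <| by simp [hfp, hgf]
  have hps : p ∘ₗ s = 0 := LinearMap.ext fun y => hf <| by simp [hfp, hgs]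
  have hfs : LinearMap.range f ⊔ LinearMap.range s = ⊤ := by
    refine eq_top_iff.mpr fun m _ => ?_
    rw [← sub_add_cancel m (s (g m))]
    exact Submodule.add_mem_sup (hmem m) ⟨_, rfl⟩
  exact ⟨(LinearEquiv.ofBijective (exteriorPower.mulMap f s a b)
    ⟨exteriorPower.mulMap_injective f s p g hpf hps hs a b,
      exteriorPower.mulMap_surjective f s hfs ha hb⟩).symm⟩
end

section
/- Let R be a commutative ring, M a finitely generated projective R-module, and r a natural number such that for every prime ideal p of R, the localization of M at p is a free module of rank r over the localization of R at p. Then ⋀[R]^r M is a finitely generated projective R-module whose localization at every prime ideal p of R is free of rank 1 over the localization of R at p. (That is, the determinant line det(M) = ⋀^{rank M} M of a rank-r vector bundle is a line bundle, so the determinant map lands in the Picard stack.) -/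
namespace exteriorPower

open TensorProduct

variable {R : Type*} [CommRing R] (A : Type*) [CommRing A] [Algebra R A] (n : ℕ)
  {M : Type*} [AddCommGroup M] [Module R M] {N : Type*} [AddCommGroup N] [Module R N]

variable (R M) in
/-- The alternating map `(m₁, …, mₙ) ↦ (1 ⊗ m₁) ∧ ⋯ ∧ (1 ⊗ mₙ)`. -/
noncomputable def baseChangeιMulti : M [⋀^Fin n]→ₗ[R] ⋀[A]^n (A ⊗[R] M) where
  toMultilinearMap := ((ιMulti A n).toMultilinearMap.restrictScalars R).compLinearMap
    fun _ ↦ TensorProduct.mk R A M 1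
  map_eq_zero_of_eq' v i j h hij :=
    (ιMulti A n).map_eq_zero_of_eq (fun k ↦ (1 : A) ⊗ₜ[R] v k) (by simp [h]) hij

lemma baseChangeιMulti_apply (v : Fin n → M) :
    baseChangeιMulti R A n M v = ιMulti A n fun i ↦ (1 : A) ⊗ₜ[R] v i := rfl

variable (R M) in
/-- The comparison map between the base change of an exterior power and the exterior power of
the base change. -/
noncomputable def baseChangeMap : A ⊗[R] ⋀[R]^n M →ₗ[A] ⋀[A]^n (A ⊗[R] M) :=
  (alternatingMapLinearEquiv (baseChangeιMulti R A n M)).liftBaseChange A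

lemma baseChangeMap_tmul_ιMulti (a : A) (v : Fin n → M) :
    baseChangeMap R A n M (a ⊗ₜ ιMulti R n v) = a • ιMulti A n fun i ↦ (1 : A) ⊗ₜ[R] v i := by
  simp [baseChangeMap, baseChangeιMulti_apply]

lemma baseChangeMap_naturality (f : M →ₗ[R] N) :
    baseChangeMap R A n N ∘ₗ (map n f).baseChange A =
      map n (f.baseChange A) ∘ₗ baseChangeMap R A n M := by
  ext v : 4
  simp [baseChangeMap_tmul_ιMulti, Function.comp_def]

lemma baseChangeMap_bijective_of_basis {I : Type*} [LinearOrder I] (b : Module.Basis I R M) :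
    Function.Bijective (baseChangeMap R A n M) := by
  let e := ((b.exteriorPower n).baseChange A).equiv ((b.baseChange A).exteriorPower n) (.refl _)
  have h : baseChangeMap R A n M = e := by
    refine ((b.exteriorPower n).baseChange A).ext fun s ↦ ?_
    rw [LinearEquiv.coe_coe, Module.Basis.equiv_apply]
    simp [ιMulti_family, baseChangeMap_tmul_ιMulti, Function.comp_def]
  rw [h]
  exact e.bijective

lemma baseChangeMap_bijective_of_retract (i : M →ₗ[R] N) (p : N →ₗ[R] M) (h : p ∘ₗ i = .id)
    (hN : Function.Bijective (baseChangeMap R A n N)) :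
    Function.Bijective (baseChangeMap R A n M) := by
  constructor
  · refine .of_comp (f := map n (i.baseChange A)) ?_
    rw [← LinearMap.coe_comp, ← baseChangeMap_naturality, LinearMap.coe_comp]
    refine hN.1.comp (Function.LeftInverse.injective (g := (map n p).baseChange A) fun x ↦ ?_)
    rw [← LinearMap.comp_apply, ← LinearMap.baseChange_comp, ← map_comp, h, map_id,
      LinearMap.baseChange_id, LinearMap.id_apply]
  · refine .of_comp (g := (map n p).baseChange A) ?_
    rw [← LinearMap.coe_comp, baseChangeMap_naturality, LinearMap.coe_comp]
    refine Function.Surjective.comp (map_surjective (Function.RightInverse.surjective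
      (g := i.baseChange A) fun x ↦ ?_)) hN.2
    rw [← LinearMap.comp_apply, ← LinearMap.baseChange_comp, h, LinearMap.baseChange_id,
      LinearMap.id_apply]

variable (R M) in
lemma baseChangeMap_bijective [Module.Projective R M] :
    Function.Bijective (baseChangeMap R A n M) := by
  classical
  obtain ⟨s, hs⟩ := Module.projective_def'.mp ‹Module.Projective R M›
  let : LinearOrder M := linearOrderOfSTO WellOrderingRel
  exact baseChangeMap_bijective_of_retract A n s _ hs
    (baseChangeMap_bijective_of_basis A n Finsupp.basisSingleOne)

variable (R M) in
/-- Exterior powers of projective modules commute with base change. -/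
noncomputable def baseChangeEquiv [Module.Projective R M] :
    A ⊗[R] ⋀[R]^n M ≃ₗ[A] ⋀[A]^n (A ⊗[R] M) :=
  .ofBijective _ (baseChangeMap_bijective R A n M)

instance projective [Module.Projective R M] : Module.Projective R (⋀[R]^n M) := by
  obtain ⟨s, hs⟩ := Module.projective_def'.mp ‹Module.Projective R M›
  exact .of_split (map n s) (map n (Finsupp.linearCombination R id)) (by rw [← map_comp, hs, map_id])

lemma rankAtStalk_eq [Module.Finite R M] [Module.Projective R M] (p : PrimeSpectrum R) :
    Module.rankAtStalk (⋀[R]^n M) p = (Module.rankAtStalk M p).choose n := by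
  have : Module.Free (Localization.AtPrime p.asIdeal) (Localization.AtPrime p.asIdeal ⊗[R] M) :=
    Module.free_of_flat_of_isLocalRing
  rw [Module.rankAtStalk_eq_finrank_tensorProduct, Module.rankAtStalk_eq_finrank_tensorProduct,
    (baseChangeEquiv R (Localization.AtPrime p.asIdeal) n M).finrank_eq, finrank_eq]

end exteriorPower

/-- The determinant line of a rank-`r` vector bundle is a line bundle: if `M` is a finitely
generated projective `R`-module all of whose localizations at primes are free of rank `r`,
then `⋀^r M` is a finitely generated projective module all of whose localizations at primes
are free of rank `1`. -/
theorem det_line_bundle_of_rank_r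
    (R : Type*) [CommRing R] (M : Type*) [AddCommGroup M] [Module R M]
    [Module.Finite R M] [Module.Projective R M] (r : ℕ)
    (hfree : ∀ (p : Ideal R) [p.IsPrime],
      Module.Free (Localization.AtPrime p) (LocalizedModule p.primeCompl M))
    (hrank : ∀ (p : Ideal R) [p.IsPrime],
      Module.finrank (Localization.AtPrime p) (LocalizedModule p.primeCompl M) = r) :
    Module.Finite R (⋀[R]^r M) ∧ Module.Projective R (⋀[R]^r M) ∧
    (∀ (p : Ideal R) [p.IsPrime],
      Module.Free (Localization.AtPrime p) (LocalizedModule p.primeCompl (⋀[R]^r M))) ∧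
    (∀ (p : Ideal R) [p.IsPrime],
      Module.finrank (Localization.AtPrime p) (LocalizedModule p.primeCompl (⋀[R]^r M)) = 1) := by
  refine ⟨inferInstance, inferInstance, fun p _ ↦ ?_, fun p hp ↦ ?_⟩
  · exact Module.free_of_flat_of_isLocalRing (R := Localization.AtPrime p)
      (P := LocalizedModule p.primeCompl (⋀[R]^r M))
  · have h := exteriorPower.rankAtStalk_eq (M := M) r ⟨p, hp⟩
    simpa only [Module.rankAtStalk, hrank, Nat.choose_self] using h
end

section
/- Let R be a commutative ring and let P be a bounded complex of finitely generated projective R-modules. Suppose that (a) the homology of P vanishes in all negative (homological) degrees, i.e. P is connective, and (b) P has projective amplitude ≤ 0, i.e. for every R-module N and every integer m ≥ 1, the group of morphisms in the derived category D(R) from P to the complex consisting of N placed in homological degree m is zero (for P itself a module concentrated in degree 0, this group is Ext^m_R(P, N)). Then the zeroth homology H₀(P) is a finitely generated projective R-module, and P is isomorphic in D(R) to the complex consisting of H₀(P) concentrated in degree 0. -/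
open CategoryTheory Limits

universe u

namespace HomologicalComplex

variable {C : Type*} [Category* C] [Abelian C]

lemma isZero_homology_of_forall_subsingleton_hom_single [HasDerivedCategory C]
    (K : CochainComplex C ℤ) (i : ℤ)
    (h : ∀ N : C, Subsingleton (DerivedCategory.Q.obj K ⟶
      (DerivedCategory.singleFunctor C i).obj N)) :
    IsZero (K.homology i) := by
  let φ : K ⟶ (HomologicalComplex.single C (ComplexShape.up ℤ) i).obj (K.opcycles i) :=
    mkHomToSingle (K.pOpcycles i) (by simp)
  have hφ : homologyMap φ i ≫ (singleObjHomologySelfIso _ _ _).hom = K.homologyι i := by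
    rw [← cancel_epi (K.homologyπ i), homologyπ_naturality_assoc,
      homologyπ_singleObjHomologySelfIso_hom, singleObjCyclesSelfIso_hom, cyclesMap_i_assoc]
    simp [φ]
  have hQ : DerivedCategory.Q.map φ = 0 := (h (K.opcycles i)).elim _ _
  have hH : homologyMap φ i = 0 := by
    refine (cancel_epi ((DerivedCategory.homologyFunctorFactors C i).hom.app K)).1 ?_
    refine (DerivedCategory.homologyFunctorFactors_hom_naturality φ i).symm.trans ?_
    rw [hQ, Functor.map_zero, zero_comp]
    exact comp_zero.symm
  rw [hH, zero_comp] at hφ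
  rw [IsZero.iff_id_eq_zero, ← cancel_mono (K.homologyι i), ← hφ, comp_zero, comp_zero]

/-- If `K` is exact in degree `i + 1` and the cycles in that degree are projective,
then the cycles in degree `i` split off. -/
lemma nonempty_retract_cycles_of_projective (K : CochainComplex C ℤ) (i : ℤ)
    [Projective (K.cycles (i + 1))] (h : IsZero (K.homology (i + 1))) :
    Nonempty (Retract (K.cycles i) (K.X i)) := by
  have : Epi (K.toCycles i (i + 1)) :=
    Preadditive.epi_of_isZero_cokernel' _ (K.homologyIsCokernel i (i + 1) (by simp)) h
  let s := Projective.factorThru (𝟙 (K.cycles (i + 1))) (K.toCycles i (i + 1))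
  have hs : s ≫ K.toCycles i (i + 1) = 𝟙 _ := Projective.factorThru_comp _ _
  refine ⟨⟨K.iCycles i,
    K.liftCycles (𝟙 _ - K.toCycles i (i + 1) ≫ s) (i + 1) (by simp) ?_, ?_⟩⟩
  · rw [Preadditive.sub_comp, Category.id_comp, Category.assoc, ← K.toCycles_i i (i + 1),
      reassoc_of% hs, sub_self]
  · have h₀ : K.iCycles i ≫ K.toCycles i (i + 1) = 0 := by
      rw [← cancel_mono (K.iCycles (i + 1))]
      simp
    rw [← cancel_mono (K.iCycles i)]
    simp [reassoc_of% h₀]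

lemma nonempty_retract_cycles (K : CochainComplex C ℤ) (a b : ℤ)
    (hproj : ∀ i, Projective (K.X i)) (hb : ∀ i, b < i → IsZero (K.X i))
    (h : ∀ i, a < i → IsZero (K.homology i)) (i : ℤ) (hi : a ≤ i) :
    Nonempty (Retract (K.cycles i) (K.X i)) := by
  obtain ⟨n, hn⟩ : ∃ n : ℕ, b < i + n := ⟨(b + 1 - i).toNat, by lia⟩
  induction n generalizing i with
  | zero =>
    have hX := hb i (by simpa using hn)
    exact ⟨⟨K.iCycles i, 0, (IsZero.of_mono (K.iCycles i) hX).eq_of_src _ _⟩⟩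
  | succ n hrec =>
    obtain ⟨r⟩ := hrec (i + 1) (by lia) (by push_cast at hn; lia)
    have := hproj (i + 1)
    have : Projective (K.cycles (i + 1)) := r.projective
    exact K.nonempty_retract_cycles_of_projective i (h _ (by lia))

end HomologicalComplex

namespace DerivedCategory

variable {C : Type*} [Category* C] [Abelian C] [HasDerivedCategory C]

lemma nonempty_iso_singleFunctor_obj_homology (K : CochainComplex C ℤ) (n : ℤ)
    (h : ∀ i, i ≠ n → IsZero (K.homology i)) :
    Nonempty (Q.obj K ≅ (singleFunctor C n).obj (K.homology n)) := by
  have : (Q.obj K).IsGE n := by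
    rw [isGE_Q_obj_iff, CochainComplex.isGE_iff]
    intro i hi
    rw [HomologicalComplex.exactAt_iff_isZero_homology]
    exact h i (by lia)
  have : (Q.obj K).IsLE n := by
    rw [isLE_Q_obj_iff, CochainComplex.isLE_iff]
    intro i hi
    rw [HomologicalComplex.exactAt_iff_isZero_homology]
    exact h i (by lia)
  obtain ⟨Y, ⟨e⟩⟩ := exists_iso_singleFunctor_obj_of_isGE_of_isLE (Q.obj K) n
  let e' : K.homology n ≅ Y :=
    ((homologyFunctorFactors C n).app K).symm ≪≫
      (homologyFunctor C n).mapIso e ≪≫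
      (homologyFunctorFactors C n).app
        ((HomologicalComplex.single C (ComplexShape.up ℤ) n).obj Y) ≪≫
      HomologicalComplex.singleObjHomologySelfIso _ _ _
  exact ⟨e ≪≫ (singleFunctor C n).mapIso e'.symm⟩

lemma projective_of_subsingleton_hom_singleFunctor (X : C)
    (h : ∀ N : C, Subsingleton ((singleFunctor C 0).obj X ⟶ (singleFunctor C (-1)).obj N)) :
    Projective X := by
  have := hasExt_of_hasDerivedCategory C
  rw [projective_iff_subsingleton_ext_one]
  intro N
  have := h N
  refine ⟨fun α β ↦ Abelian.Ext.homEquiv.injective ?_⟩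
  rw [← cancel_mono (((singleFunctors C).shiftIso 1 (-1) 0 (by lia)).hom.app N)]
  exact Subsingleton.elim (α := (singleFunctor C 0).obj X ⟶ (singleFunctor C (-1)).obj N) _ _

end DerivedCategory

/-- A bounded complex of finitely generated projective modules over a commutative ring `R`
which is connective (no homology in negative homological = positive cohomological degrees)
and has projective amplitude `≤ 0` (no maps in the derived category to a module placed in
homological degree `m ≥ 1`, i.e. cohomological degree `-m`) has finitely generated
projective `H₀`, and is isomorphic in the derived category to `H₀` placed in degree `0`. -/
theorem perfect_connective_amplitude_le_zero_is_vector_bundle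
    (R : Type u) [CommRing R] [HasDerivedCategory (ModuleCat.{u} R)]
    (P : CochainComplex (ModuleCat.{u} R) ℤ)
    (hbdd : ∃ a b : ℤ, ∀ i : ℤ, (i < a ∨ b < i) → IsZero (P.X i))
    (hfin : ∀ i : ℤ, Module.Finite R (P.X i))
    (hproj : ∀ i : ℤ, Module.Projective R (P.X i))
    (hconn : ∀ i : ℤ, 0 < i → IsZero (P.homology i))
    (hamp : ∀ (N : ModuleCat.{u} R) (m : ℤ), 1 ≤ m →
      Subsingleton (DerivedCategory.Q.obj P ⟶
        (DerivedCategory.singleFunctor (ModuleCat.{u} R) (-m)).obj N)) :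
    Module.Finite R (P.homology 0) ∧ Module.Projective R (P.homology 0) ∧
    Nonempty (DerivedCategory.Q.obj P ≅
      (DerivedCategory.singleFunctor (ModuleCat.{u} R) 0).obj (P.homology 0)) := by
  obtain ⟨a, b, hab⟩ := hbdd
  have hzero (i : ℤ) (hi : i ≠ 0) : IsZero (P.homology i) := by
    obtain hi | hi := lt_or_gt_of_ne hi
    · refine P.isZero_homology_of_forall_subsingleton_hom_single i fun N ↦ ?_
      simpa using hamp N (-i) (by lia)
    · exact hconn i hi
  obtain ⟨e⟩ := DerivedCategory.nonempty_iso_singleFunctor_obj_homology P 0 hzero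
  refine ⟨?_, ?_, ⟨e⟩⟩
  · obtain ⟨r⟩ := P.nonempty_retract_cycles 0 b
      (fun i ↦ (IsProjective.iff_projective (P.X i)).1 (hproj i))
      (fun i hi ↦ hab i (Or.inr hi)) hconn 0 le_rfl
    have := hfin 0
    exact Module.Finite.of_surjective (r.r ≫ P.homologyπ 0).hom
      ((ModuleCat.epi_iff_surjective _).1 inferInstance)
  · rw [IsProjective.iff_projective]
    refine DerivedCategory.projective_of_subsingleton_hom_singleFunctor (P.homology 0) fun N ↦ ?_
    have := hamp N 1 le_rfl
    exact ⟨fun f g ↦ by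
      rw [← cancel_epi e.hom]
      exact Subsingleton.elim _ _⟩
end
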